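/- arXiv:1611.01735 — 2 statements merged into one kernel-verified Lean document; each statement's English description precedes it below -/
import Mathlib

section
/- Let n, t, k_1, ..., k_t be positive integers with n > 3k^2·t where k = max{k_i : i ∈ [t]}. For each i in [t], let F_i ⊆ C([n], k_i) with |F_i| > C(n, k_i) - C(n-t+1, k_i). Then {F_1, ..., F_t} admits a rainbow matching. -/
open Finset

section RainbowMatching

variable {α ι : Type*} [DecidableEq α] [DecidableEq ι]

/-- The number of `k`-subsets of an `n`-set that contain two given elements. -/
def chooseCodegree (n k : ℕ) : ℕ := if k ≤ 1 then 0 else (n - 2).choose (k - 2)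

theorem choose_add_le_add_mul_chooseCodegree {n N k : ℕ} (m : ℕ) (hk : 1 ≤ k)
    (h : N + m ≤ n - 1) :
    (N + m).choose (k - 1) ≤ N.choose (k - 1) + m * chooseCodegree n k := by
  rcases Nat.lt_or_ge 1 k with hk1 | hk1
  · obtain ⟨j, rfl⟩ : ∃ j, k = j + 2 := ⟨k - 2, by omega⟩
    have hc : chooseCodegree n (j + 2) = (n - 2).choose j := by simp [chooseCodegree]
    rw [hc]
    induction m with
    | zero => simp
    | succ m ih =>
      have h1 := ih (by omega)
      have h2 : (N + m).choose j ≤ (n - 2).choose j := Nat.choose_le_choose _ (by omega)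
      have h3 : (N + (m + 1)).choose (j + 2 - 1) = (N + m).choose j + (N + m).choose (j + 1) :=
        Nat.choose_succ_succ _ _
      simp only [show j + 2 - 1 = j + 1 from rfl] at *
      nlinarith
  · obtain rfl : k = 1 := by omega
    simp

theorem choose_add_mul_choose_pred_le (N m : ℕ) {k : ℕ} (hk : 1 ≤ k) :
    N.choose k + m * N.choose (k - 1) ≤ (N + m).choose k := by
  obtain ⟨j, rfl⟩ : ∃ j, k = j + 1 := ⟨k - 1, by omega⟩
  induction m with
  | zero => simp
  | succ m ih =>
    have h2 : N.choose j ≤ (N + m).choose j := Nat.choose_le_choose _ (by omega)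
    have h3 : (N + (m + 1)).choose (j + 1) = (N + m).choose j + (N + m).choose (j + 1) :=
      Nat.choose_succ_succ _ _
    simp only [show j + 1 - 1 = j from rfl] at *
    nlinarith

theorem choose_add_mul_chooseCodegree_le {n t k K : ℕ} (hk : 1 ≤ k) (hkK : k ≤ K) (ht : 2 ≤ t)
    (hn : 3 * K ^ 2 * t < n) :
    (n + 1 - t).choose k + 3 * K * (t - 1) ^ 2 * chooseCodegree n k ≤ n.choose k := by
  rcases Nat.lt_or_ge 1 k with hk1 | hk1
  · obtain ⟨m, rfl⟩ : ∃ m, t = m + 2 := ⟨t - 2, by omega⟩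
    obtain ⟨j, rfl⟩ : ∃ j, k = j + 2 := ⟨k - 2, by omega⟩
    obtain ⟨L, rfl⟩ : ∃ L, K = L + 1 := ⟨K - 1, by omega⟩
    have hlt : m + 2 < n := by
      nlinarith [Nat.zero_le L, Nat.zero_le (L ^ 2 * (m + 2)), Nat.zero_le (L * (m + 2))]
    obtain ⟨N, rfl⟩ : ∃ N, n = N + m + 1 := ⟨n - m - 1, by omega⟩
    have e1 : N + m + 1 + 1 - (m + 2) = N := by omega
    have h1 := choose_add_mul_choose_pred_le N (m + 1) hk
    have h2 := choose_add_le_add_mul_chooseCodegree (n := N + m + 1) (N := N) m hk (by omega)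
    have hc : chooseCodegree (N + m + 1) (j + 2) = (N + m - 1).choose j := by
      simp [chooseCodegree]
    have h3 : (N + m) * (N + m - 1).choose j = (N + m).choose (j + 1) * (j + 1) := by
      have := Nat.add_one_mul_choose_eq (N + m - 1) j
      rwa [Nat.sub_add_cancel (by omega)] at this
    rw [hc] at h2
    rw [e1, hc, show m + 2 - 1 = m + 1 from rfl]
    rw [show j + 2 - 1 = j + 1 from rfl] at h1 h2
    set c := (N + m - 1).choose j
    set d := (N + m).choose (j + 1)
    have h4 : (j + 1) * (3 * (L + 1) * (m + 1) + m) ≤ N + m := by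
      have : (j + 1) * (3 * (L + 1) * (m + 1) + m) ≤ L * (3 * (L + 1) * (m + 1) + m) :=
        Nat.mul_le_mul_right _ (by omega)
      nlinarith
    have h5 : (3 * (L + 1) * (m + 1) + m) * c ≤ d := by
      refine Nat.le_of_mul_le_mul_left (c := j + 1) ?_ (by omega)
      calc _ = ((j + 1) * (3 * (L + 1) * (m + 1) + m)) * c := by ring
        _ ≤ (N + m) * c := Nat.mul_le_mul_right _ h4
        _ = _ := by rw [h3]; ring
    have h6 : 3 * (L + 1) * (m + 1) * c ≤ N.choose (j + 1) := by nlinarith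
    have h7 := Nat.mul_le_mul_left (m + 1) h6
    rw [← add_assoc] at h1
    nlinarith
  · obtain rfl : k = 1 := by omega
    simp [chooseCodegree]
    omega

theorem card_filter_mem_eq_card_image_erase (F : Finset (Finset α)) (v : α) :
    #{e ∈ F | v ∈ e} = #({e ∈ F | v ∈ e}.image (·.erase v)) := by
  refine (card_image_of_injOn fun a ha b hb hab => ?_).symm
  simp only [coe_filter, Set.mem_ofPred_eq] at ha hb
  rw [← insert_erase ha.2, ← insert_erase hb.2]
  exact congrArg (insert v) hab

theorem image_erase_subset_powersetCard {F : Finset (Finset α)} {V : Finset α} {k : ℕ}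
    (hF : F ⊆ powersetCard k V) (v : α) :
    {e ∈ F | v ∈ e}.image (·.erase v) ⊆ powersetCard (k - 1) (V.erase v) := by
  intro x hx
  obtain ⟨e, he, rfl⟩ := mem_image.1 hx
  obtain ⟨heF, hve⟩ := mem_filter.1 he
  obtain ⟨h1, h2⟩ := mem_powersetCard.1 (hF heF)
  exact mem_powersetCard.2 ⟨erase_subset_erase _ h1, by rw [card_erase_of_mem hve, h2]⟩

theorem card_filter_mem_le_choose {F : Finset (Finset α)} {V : Finset α} {k : ℕ}
    (hF : F ⊆ powersetCard k V) {v : α} (hv : v ∈ V) :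
    #{e ∈ F | v ∈ e} ≤ (#V - 1).choose (k - 1) := by
  rw [card_filter_mem_eq_card_image_erase, ← card_erase_of_mem hv, ← card_powersetCard]
  exact card_le_card (image_erase_subset_powersetCard hF v)

theorem card_filter_mem_mem_le_chooseCodegree {F : Finset (Finset α)} {V : Finset α} {k : ℕ}
    (hF : F ⊆ powersetCard k V) {u v : α} (hu : u ∈ V) (hv : v ∈ V) (huv : u ≠ v) :
    #{e ∈ {e ∈ F | v ∈ e} | u ∈ e} ≤ chooseCodegree #V k := by
  rcases Nat.lt_or_ge 1 k with hk | hk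
  · have h := card_filter_mem_le_choose (image_erase_subset_powersetCard hF v)
      (mem_erase.2 ⟨huv, hu⟩)
    rw [card_erase_of_mem hv] at h
    rw [chooseCodegree, if_neg (by omega)]
    refine le_trans ?_ h
    refine card_le_card_of_injOn (·.erase v) (fun e he => ?_) fun a ha b hb hab => ?_
    · simp only [coe_filter, mem_filter, Set.mem_ofPred_eq] at he
      simp only [coe_filter, Set.mem_ofPred_eq, mem_image, mem_filter]
      exact ⟨⟨e, he.1, rfl⟩, mem_erase.2 ⟨huv, he.2⟩⟩
    · simp only [coe_filter, mem_filter, Set.mem_ofPred_eq] at ha hb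
      rw [← insert_erase ha.1.2, ← insert_erase hb.1.2]
      exact congrArg (insert v) hab
  · rw [card_eq_zero.2, chooseCodegree, if_pos hk]
    refine filter_eq_empty_iff.2 fun e he hue => huv ?_
    obtain ⟨heF, hve⟩ := mem_filter.1 he
    have := (mem_powersetCard.1 (hF heF)).2
    exact card_le_one.1 (by omega) u hue v hve

theorem card_filter_not_disjoint_le_sum (F : Finset (Finset α)) (U : Finset α) :
    #{e ∈ F | ¬Disjoint e U} ≤ ∑ u ∈ U, #{e ∈ F | u ∈ e} := by
  refine le_trans (card_le_card fun e he => ?_) card_biUnion_le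
  obtain ⟨heF, h⟩ := mem_filter.1 he
  obtain ⟨u, hue, huU⟩ := not_disjoint_iff.1 h
  exact mem_biUnion.2 ⟨u, huU, mem_filter.2 ⟨heF, hue⟩⟩

theorem exists_disjoint_of_sum_lt {F : Finset (Finset α)} {U : Finset α}
    (h : ∑ u ∈ U, #{e ∈ F | u ∈ e} < #F) : ∃ e ∈ F, Disjoint e U := by
  by_contra! hne
  have := card_filter_not_disjoint_le_sum F U
  rw [filter_true_of_mem hne] at this
  omega

/-- `e` chooses pairwise disjoint members of the families indexed by `s`. -/
def IsRainbowMatching (s : Finset ι) (F : ι → Finset (Finset α)) (e : ι → Finset α) : Prop :=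
  (∀ i ∈ s, e i ∈ F i) ∧ ∀ i ∈ s, ∀ j ∈ s, i ≠ j → Disjoint (e i) (e j)

theorem IsRainbowMatching.update {s : Finset ι} {F : ι → Finset (Finset α)} {e : ι → Finset α}
    {i : ι} (h : IsRainbowMatching (s.erase i) F e) {x : Finset α} (hx : x ∈ F i)
    (hd : Disjoint x ((s.erase i).biUnion e)) :
    IsRainbowMatching s F (Function.update e i x) := by
  rw [disjoint_biUnion_right] at hd
  refine ⟨fun j hj => ?_, fun j hj l hl hjl => ?_⟩
  · by_cases hji : j = i
    · subst hji; simpa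
    · simpa [hji] using h.1 j (mem_erase.2 ⟨hji, hj⟩)
  · by_cases hji : j = i
    · subst hji
      simpa [hjl.symm] using hd l (mem_erase.2 ⟨hjl.symm, hl⟩)
    · by_cases hli : l = i
      · subst hli
        simpa [hji] using (hd j (mem_erase.2 ⟨hji, hj⟩)).symm
      · simpa [hji, hli] using h.2 j (mem_erase.2 ⟨hji, hj⟩) l (mem_erase.2 ⟨hli, hl⟩) hjl

theorem exists_injOn_mem_of_card_le {s : Finset ι} {H : ι → Finset α} (hs : s.Nonempty)
    (h : ∀ i ∈ s, #s ≤ #(H i)) : ∃ v : ι → α, Set.InjOn v s ∧ ∀ i ∈ s, v i ∈ H i := by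
  obtain ⟨i₀, hi₀⟩ := hs
  obtain ⟨f, hf, hfH⟩ := (all_card_le_biUnion_card_iff_exists_injective
    (fun i : s => H i)).1 fun r => by
      rcases r.eq_empty_or_nonempty with rfl | ⟨i, hi⟩
      · simp
      · calc #r ≤ #s := by simpa using card_le_univ r
          _ ≤ #(H i) := h i i.2
          _ ≤ _ := card_le_card (subset_biUnion_of_mem (fun i : s => H i) hi)
  refine ⟨fun i => if hi : i ∈ s then f ⟨i, hi⟩ else f ⟨i₀, hi₀⟩, fun i hi j hj hij => ?_,
    fun i hi => ?_⟩
  · simp only [mem_coe] at hi hj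
    simp only [hi, hj, dif_pos] at hij
    exact congrArg Subtype.val (hf hij)
  · simpa [hi] using hfH ⟨i, hi⟩

theorem exists_isRainbowMatching {s : Finset ι} {K : ℕ} {V : Finset α} {k : ι → ℕ}
    {F : ι → Finset (Finset α)} (hk : ∀ i ∈ s, k i ≤ K) (hn : 3 * K ^ 2 * #s < #V)
    (hF : ∀ i ∈ s, F i ⊆ powersetCard (k i) V)
    (hc : ∀ i ∈ s, (#V).choose (k i) < #(F i) + (#V + 1 - #s).choose (k i)) :
    ∃ e, IsRainbowMatching s F e := by
  induction hm : K + #s using Nat.strong_induction_on generalizing s K V k F with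
  | _ m ih =>
  subst hm
  rcases s.eq_empty_or_nonempty with rfl | hs
  · exact ⟨fun _ => ∅, by simp [IsRainbowMatching]⟩
  have hs1 : 1 ≤ #s := hs.card_pos
  have covering : ∀ i ∈ s, ∃ e, IsRainbowMatching (s.erase i) F e := fun i hi => by
    have hcard := card_erase_of_mem hi
    refine ih (K + #(s.erase i)) (by omega) (fun j hj => hk j (mem_of_mem_erase hj)) ?_
      (fun j hj => hF j (mem_of_mem_erase hj)) (fun j hj => ?_) rfl
    · exact lt_of_le_of_lt (Nat.mul_le_mul_left _ (by omega)) hn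
    · have h1 := hc j (mem_of_mem_erase hj)
      have h2 : (#V + 1 - #s).choose (k j) ≤ (#V + 1 - #(s.erase i)).choose (k j) :=
        Nat.choose_le_choose _ (by omega)
      omega
  have card_union : ∀ i ∈ s, ∀ e, IsRainbowMatching (s.erase i) F e →
      #((s.erase i).biUnion e) ≤ K * (#s - 1) := fun i hi e he => by
    rw [mul_comm, ← card_erase_of_mem hi]
    refine card_biUnion_le_card_mul _ _ _ fun j hj => ?_
    rw [(mem_powersetCard.1 (hF j (mem_of_mem_erase hj) (he.1 j hj))).2]
    exact hk j (mem_of_mem_erase hj)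
  have union_subset : ∀ i, ∀ e, IsRainbowMatching (s.erase i) F e →
      (s.erase i).biUnion e ⊆ V := fun i e he =>
    biUnion_subset.2 fun j hj => (mem_powersetCard.1 (hF j (mem_of_mem_erase hj) (he.1 j hj))).1
  by_cases hk0 : ∃ i ∈ s, k i = 0
  · obtain ⟨i, hi, hki⟩ := hk0
    obtain ⟨e, he⟩ := covering i hi
    have hci := hc i hi
    simp only [hki, Nat.choose_zero_right] at hci
    obtain ⟨x, hx⟩ : (F i).Nonempty := card_pos.1 (by omega)
    have := (mem_powersetCard.1 (hF i hi hx)).2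
    rw [hki, card_eq_zero] at this
    subst this
    exact ⟨_, he.update hx (disjoint_empty_left _)⟩
  have hk1 : ∀ i ∈ s, 1 ≤ k i := fun i hi =>
    Nat.one_le_iff_ne_zero.2 fun h => hk0 ⟨i, hi, h⟩
  have hK : 1 ≤ K := by
    obtain ⟨i, hi⟩ := hs
    exact (hk1 i hi).trans (hk i hi)
  have hsV : 3 * #s < #V := by nlinarith [Nat.mul_le_mul_right #s (Nat.pow_le_pow_left hK 2)]
  by_cases hdeg : ∃ i ∈ s, ∃ v ∈ V,
      K * (#s - 1) * chooseCodegree #V (k i) < #{e ∈ F i | v ∈ e}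
  · obtain ⟨i, hi, v, hv, hdeg⟩ := hdeg
    have hcard := card_erase_of_mem hi
    have hcardV := card_erase_of_mem hv
    obtain ⟨e, he⟩ : ∃ e, IsRainbowMatching (s.erase i) (fun j => {e ∈ F j | v ∉ e}) e := by
      refine ih (K + #(s.erase i)) (by omega) (V := V.erase v)
        (fun j hj => hk j (mem_of_mem_erase hj)) ?_ (fun j hj x hx => ?_) (fun j hj => ?_) rfl
      · rw [hcard, hcardV]
        obtain ⟨a, ha⟩ : ∃ a, #s = a + 1 := ⟨#s - 1, by omega⟩
        rw [ha] at hn ⊢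
        have : 1 ≤ K ^ 2 := Nat.one_le_pow _ _ hK
        rw [Nat.add_sub_cancel]
        refine Nat.lt_sub_of_add_lt ?_
        nlinarith
      · obtain ⟨hxF, hvx⟩ := mem_filter.1 hx
        obtain ⟨h1, h2⟩ := mem_powersetCard.1 (hF j (mem_of_mem_erase hj) hxF)
        exact mem_powersetCard.2 ⟨subset_erase.2 ⟨h1, hvx⟩, h2⟩
      · have hj' := mem_of_mem_erase hj
        have h1 := hc j hj'
        have h2 := card_filter_mem_le_choose (hF j hj') hv
        have h3 := card_filter_add_card_filter_not (s := F j) (fun e => v ∈ e)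
        have h4 : (#V).choose (k j) = (#V - 1).choose (k j - 1) + (#V - 1).choose (k j) := by
          have := Nat.choose_succ_succ (#V - 1) (k j - 1)
          simpa [Nat.sub_add_cancel (hk1 j hj'), Nat.sub_add_cancel (card_pos.2 ⟨v, hv⟩)]
            using this
        rw [hcard, hcardV, show #V - 1 + 1 - (#s - 1) = #V + 1 - #s by omega]
        omega
    have he' : IsRainbowMatching (s.erase i) F e :=
      ⟨fun j hj => mem_of_mem_filter _ (he.1 j hj), he.2⟩
    have hvU : v ∉ (s.erase i).biUnion e := fun h => by
      obtain ⟨j, hj, hvj⟩ := mem_biUnion.1 h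
      exact (mem_filter.1 (he.1 j hj)).2 hvj
    obtain ⟨x, hx, hxd⟩ := exists_disjoint_of_sum_lt (F := {e ∈ F i | v ∈ e})
      (U := (s.erase i).biUnion e) <| by
        refine lt_of_le_of_lt (sum_le_card_nsmul _ _ (chooseCodegree #V (k i)) fun u hu => ?_)
          (lt_of_le_of_lt ?_ hdeg)
        · exact card_filter_mem_mem_le_chooseCodegree (hF i hi) (union_subset i e he' hu) hv
            fun h => hvU (h ▸ hu)
        · exact Nat.mul_le_mul_right _ (card_union i hi e he')
    exact ⟨_, he'.update (mem_of_mem_filter _ hx) hxd⟩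
  push Not at hdeg
  let H : ι → Finset α := fun i =>
    {v ∈ V | 2 * (#s - 1) * chooseCodegree #V (k i) < #{e ∈ F i | v ∈ e}}
  by_cases hH : ∃ i ∈ s, #(H i) < #s
  · obtain ⟨i, hi, hH⟩ := hH
    obtain ⟨e, he⟩ := covering i hi
    obtain ⟨x, hx, hxd⟩ := exists_disjoint_of_sum_lt (F := F i)
      (U := (s.erase i).biUnion e) <| by
        have hU := card_union i hi e he
        have hUV := union_subset i e he
        set U := (s.erase i).biUnion e
        set c := chooseCodegree #V (k i) with hc_def
        have hci := hc i hi
        have hlow : (#V + 1 - #s).choose (k i) + 3 * K * (#s - 1) ^ 2 * c ≤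
            (#V).choose (k i) := by
          rcases Nat.lt_or_ge 1 #s with h2 | h2
          · exact choose_add_mul_chooseCodegree_le (hk1 i hi) (hk i hi) h2 hn
          · simp [show #s = 1 by omega]
        have h1 : ∑ u ∈ U with u ∈ H i, #{e ∈ F i | u ∈ e} ≤
            (#s - 1) * (K * (#s - 1) * c) := by
          refine (sum_le_card_nsmul _ _ (K * (#s - 1) * c) fun u hu =>
            hdeg i hi u (hUV (mem_of_mem_filter _ hu))).trans ?_
          refine Nat.mul_le_mul_right _ ?_
          have : #{u ∈ U | u ∈ H i} ≤ #(H i) :=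
            card_le_card fun u hu => (mem_filter.1 hu).2
          omega
        have h2 : ∑ u ∈ U with u ∉ H i, #{e ∈ F i | u ∈ e} ≤
            K * (#s - 1) * (2 * (#s - 1) * c) := by
          refine (sum_le_card_nsmul _ _ (2 * (#s - 1) * c) fun u hu => ?_).trans ?_
          · obtain ⟨huU, huH⟩ := mem_filter.1 hu
            by_contra! hlt
            exact huH (mem_filter.2 ⟨hUV huU, hlt⟩)
          · exact Nat.mul_le_mul_right _ ((card_filter_le _ _).trans hU)
        rw [← sum_filter_add_sum_filter_not U (· ∈ H i)]
        nlinarith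
    exact ⟨_, he.update hx hxd⟩
  push Not at hH
  obtain ⟨v, hvinj, hvH⟩ := exists_injOn_mem_of_card_le hs hH
  have hvV : s.image v ⊆ V := image_subset_iff.2 fun i hi => mem_of_mem_filter _ (hvH i hi)
  have hcardW : #(V \ s.image v) = #V - #s := by
    rw [card_sdiff_of_subset hvV, card_image_of_injOn hvinj]
  let G : ι → Finset (Finset α) := fun i =>
    {e ∈ {e ∈ F i | v i ∈ e} | Disjoint e ((s.erase i).image v)}
  have hGsub : ∀ i, G i ⊆ {e ∈ F i | v i ∈ e} := fun i => filter_subset _ _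
  have hGcard : ∀ i ∈ s, (#s - 1) * chooseCodegree #V (k i) < #(G i) := fun i hi => by
    have h1 := card_filter_not_disjoint_le_sum {e ∈ F i | v i ∈ e} ((s.erase i).image v)
    have h2 := sum_le_card_nsmul ((s.erase i).image v)
      (fun u => #{e ∈ {e ∈ F i | v i ∈ e} | u ∈ e}) (chooseCodegree #V (k i)) fun u hu => by
        obtain ⟨j, hj, rfl⟩ := mem_image.1 hu
        obtain ⟨hji, hj⟩ := mem_erase.1 hj
        exact card_filter_mem_mem_le_chooseCodegree (hF i hi) (hvV (mem_image_of_mem v hj))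
          (hvV (mem_image_of_mem v hi)) fun h => hji (hvinj hj hi h)
    have h3 : #((s.erase i).image v) ≤ #s - 1 := by
      rw [← card_erase_of_mem hi]; exact card_image_le
    have h4 := Nat.mul_le_mul_right (chooseCodegree #V (k i)) h3
    have h5 := (mem_filter.1 (hvH i hi)).2
    have h6 := card_filter_add_card_filter_not (s := {e ∈ F i | v i ∈ e})
      (fun e => Disjoint e ((s.erase i).image v))
    rw [smul_eq_mul] at h2
    simp only [G]
    nlinarith
  have hLcard : ∀ i, #((G i).image (·.erase (v i))) = #(G i) := fun i => by
    have := card_filter_mem_eq_card_image_erase (G i) (v i)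
    rw [filter_true_of_mem fun e he => (mem_filter.1 (hGsub i he)).2] at this
    exact this.symm
  obtain ⟨e, he⟩ : ∃ e, IsRainbowMatching s (fun i => (G i).image (·.erase (v i))) e := by
    refine ih (K - 1 + #s) (by omega) (V := V \ s.image v) (k := fun i => k i - 1)
      (fun i hi => Nat.sub_le_sub_right (hk i hi) 1) ?_ (fun i hi x hx => ?_) (fun i hi => ?_) rfl
    · obtain ⟨L, rfl⟩ : ∃ L, K = L + 1 := ⟨K - 1, by omega⟩
      rw [hcardW, Nat.add_sub_cancel]
      refine Nat.lt_sub_of_add_lt (lt_of_le_of_lt ?_ hn)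
      nlinarith [Nat.zero_le (L * #s)]
    · have hx' := image_erase_subset_powersetCard (hF i hi) (v i)
        (image_subset_image (hGsub i) hx)
      obtain ⟨hxV, hxk⟩ := mem_powersetCard.1 hx'
      refine mem_powersetCard.2 ⟨subset_sdiff.2 ⟨hxV.trans (erase_subset _ _), ?_⟩, hxk⟩
      obtain ⟨y, hy, rfl⟩ := mem_image.1 hx
      rw [← insert_erase hi, image_insert, disjoint_insert_right]
      exact ⟨notMem_erase _ _, (mem_filter.1 hy).2.mono_left (erase_subset _ _)⟩
    · have h1 := choose_add_le_add_mul_chooseCodegree (n := #V) (N := #V - #s + 1 - #s)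
        (#s - 1) (hk1 i hi) (by omega)
      have h2 := hGcard i hi
      rw [hcardW, hLcard]
      rw [show #V - #s + 1 - #s + (#s - 1) = #V - #s by omega] at h1
      omega
  have hmem : ∀ i ∈ s, insert (v i) (e i) ∈ G i := fun i hi => by
    obtain ⟨y, hy, hye⟩ := mem_image.1 (he.1 i hi)
    rwa [← hye, insert_erase (mem_filter.1 (hGsub i hy)).2]
  refine ⟨fun i => insert (v i) (e i), fun i hi => mem_of_mem_filter _ (hGsub i (hmem i hi)),
    fun i hi j hj hij => ?_⟩
  have hdi := (mem_filter.1 (hmem i hi)).2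
  have hdj := (mem_filter.1 (hmem j hj)).2
  refine disjoint_insert_right.2 ⟨fun h => ?_, ?_⟩
  · exact disjoint_left.1 hdi h (mem_image_of_mem v (mem_erase.2 ⟨hij.symm, hj⟩))
  · refine disjoint_insert_left.2 ⟨fun h => ?_, he.2 i hi j hj hij⟩
    exact disjoint_left.1 hdj (mem_insert_of_mem h)
      (mem_image_of_mem v (mem_erase.2 ⟨hij, hi⟩))

end RainbowMatching

/-- Theorem 1.5: if `n > 3 k² t` with `k = max kᵢ`, and `|Fᵢ| > C(n,kᵢ) - C(n-t+1,kᵢ)`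
for `Fᵢ ⊆ C([n],kᵢ)`, then `{F₁, …, F_t}` admits a rainbow matching. -/
theorem rainbow_matching_erdos_type
    (n t : ℕ) (ht : 1 ≤ t) (k : Fin t → ℕ) (K : ℕ)
    (hk : ∀ i, 1 ≤ k i)
    (hK : ∀ i, k i ≤ K) (hKmem : ∃ i, k i = K)
    (hn : n > 3 * K ^ 2 * t)
    (F : Fin t → Finset (Finset (Fin n)))
    (hFuniform : ∀ i, ∀ e ∈ F i, e.card = k i)
    (hFcard : ∀ i, (F i).card > n.choose (k i) - (n - t + 1).choose (k i)) :
    ∃ e : Fin t → Finset (Fin n), (∀ i, e i ∈ F i) ∧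
      ∀ i j, i ≠ j → Disjoint (e i) (e j) := by
  have hK1 : 1 ≤ K := by
    obtain ⟨i, rfl⟩ := hKmem
    exact hk i
  have htn : t ≤ n := by nlinarith [Nat.mul_le_mul_right t (Nat.pow_le_pow_left hK1 2)]
  obtain ⟨e, he, hd⟩ := exists_isRainbowMatching (s := univ) (V := univ) (F := F)
    (fun i _ => hK i) (by simpa using hn)
    (fun i _ x hx => mem_powersetCard.2 ⟨subset_univ _, hFuniform i x hx⟩) fun i _ => by
      have := hFcard i
      rw [card_univ, card_univ, Fintype.card_fin, Fintype.card_fin,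
        show n + 1 - t = n - t + 1 by omega]
      omega
  exact ⟨e, fun i => he i (mem_univ i), fun i j => hd i (mem_univ i) j (mem_univ j)⟩
end

section
/- Let n ≥ max{2k_1, 2k_2} be positive integers and let H_i ⊆ C([n], k_i) for i = 1, 2 satisfy |H_1|·|H_2| > C(n-1, k_1-1)·C(n-1, k_2-1). Then there exist disjoint sets e_1 ∈ H_1 and e_2 ∈ H_2. -/
section LevelOperators

open Finset
open scoped FinsetFamily

variable {α : Type*} [Fintype α] [DecidableEq α]

/-- The raising operator on functions on the Boolean lattice. -/
def raise (f : Finset α → ℝ) (s : Finset α) : ℝ := ∑ x ∈ s, f (s.erase x)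

/-- The lowering operator on functions on the Boolean lattice. -/
def lower (f : Finset α → ℝ) (s : Finset α) : ℝ := ∑ x ∈ sᶜ, f (insert x s)

lemma sum_raise_mul (f g : Finset α → ℝ) :
    ∑ s, raise f s * g s = ∑ s, f s * lower g s := by
  simp only [raise, lower, sum_mul, mul_sum]
  rw [sum_sigma', sum_sigma']
  refine sum_bij' (fun p _ ↦ ⟨p.1.erase p.2, p.2⟩) (fun p _ ↦ ⟨insert p.2 p.1, p.2⟩) ?_ ?_ ?_ ?_ ?_
  · simp
  · simp
  · rintro ⟨s, x⟩ h
    simp only [mem_sigma, mem_univ, true_and] at h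
    simp [insert_erase h]
  · rintro ⟨s, x⟩ h
    simp only [mem_sigma, mem_univ, true_and, mem_compl] at h
    simp [erase_insert h]
  · rintro ⟨s, x⟩ h
    simp only [mem_sigma, mem_univ, true_and] at h
    simp [insert_erase h]

lemma lower_raise (f : Finset α → ℝ) (s : Finset α) :
    lower (raise f) s = raise (lower f) s + (Fintype.card α - 2 * #s : ℝ) * f s := by
  have h₁ : lower (raise f) s = #sᶜ * f s + ∑ x ∈ sᶜ, ∑ y ∈ s, f (insert x (s.erase y)) := by
    rw [lower, ← nsmul_eq_mul, ← sum_const, ← sum_add_distrib]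
    refine sum_congr rfl fun x hx ↦ ?_
    rw [mem_compl] at hx
    rw [raise, sum_insert hx, erase_insert hx]
    congr 1
    refine sum_congr rfl fun y hy ↦ ?_
    rw [erase_insert_of_ne (by rintro rfl; exact hx hy)]
  have h₂ : raise (lower f) s = #s * f s + ∑ y ∈ s, ∑ x ∈ sᶜ, f (insert x (s.erase y)) := by
    rw [raise, ← nsmul_eq_mul, ← sum_const, ← sum_add_distrib]
    refine sum_congr rfl fun y hy ↦ ?_
    rw [lower, compl_erase, sum_insert (by simpa using hy), insert_erase hy]
  have h₃ : (#sᶜ : ℝ) = Fintype.card α - #s := by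
    rw [card_compl, Nat.cast_sub (card_le_univ s)]
  rw [h₁, h₂, h₃, sum_comm]
  ring

lemma lower_eq_zero {f : Finset α → ℝ} {k : ℕ} (hf : ∀ s, #s ≠ k + 1 → f s = 0)
    (s : Finset α) (hs : #s ≠ k) : lower f s = 0 :=
  sum_eq_zero fun x hx ↦ hf _ <| by
    rw [mem_compl] at hx
    rw [card_insert_of_notMem hx]
    lia

lemma sum_lower {f : Finset α → ℝ} {k : ℕ} (hf : ∀ s, #s ≠ k → f s = 0) :
    ∑ s, lower f s = k * ∑ s, f s := by
  have h := sum_raise_mul (fun _ ↦ 1) f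
  simp only [one_mul] at h
  rw [← h, mul_sum]
  refine sum_congr rfl fun s _ ↦ ?_
  by_cases hs : #s = k
  · simp [raise, hs]
  · simp [hf s hs]

/-- The spectral gap of the lowering operator on mean-zero functions supported on one level. -/
lemma sum_sq_lower_le (k : ℕ) (hk : k + 1 ≤ Fintype.card α) (f : Finset α → ℝ)
    (hf : ∀ s, #s ≠ k + 1 → f s = 0) (hsum : ∑ s, f s = 0) :
    ∑ s, lower f s ^ 2 ≤ k * (Fintype.card α - (k + 1)) * ∑ s, f s ^ 2 := by
  induction k generalizing f with
  | zero =>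
    have h₀ : ∀ s, lower f s = 0 := by
      intro s
      by_cases hs : #s = 0
      · have h := sum_lower hf
        rw [hsum, mul_zero, sum_eq_single s (fun t _ ht ↦ lower_eq_zero hf t ?_) (by simp)] at h
        · exact h
        · rw [card_eq_zero] at hs
          rwa [Ne, card_eq_zero, ← hs]
      · exact lower_eq_zero hf s hs
    simp [h₀]
  | succ k ih =>
    set g := lower f with hg
    have hg₁ : ∀ s, #s ≠ k + 1 → g s = 0 := lower_eq_zero hf
    have hg₂ : ∑ s, g s = 0 := by rw [hg, sum_lower hf, hsum, mul_zero]
    have hd := ih (by lia) g hg₁ hg₂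
    have hraise : ∑ s, raise g s ^ 2
        = ∑ s, lower g s ^ 2 + (Fintype.card α - 2 * (k + 1)) * ∑ s, g s ^ 2 := by
      have hDD : ∑ s, lower g s ^ 2 = ∑ s, raise (lower g) s * g s := by
        rw [sum_raise_mul]
        exact sum_congr rfl fun s _ ↦ sq _
      have hUU : ∑ s, raise g s ^ 2 = ∑ s, g s * lower (raise g) s := by
        rw [← sum_raise_mul]
        exact sum_congr rfl fun s _ ↦ sq _
      rw [hDD, hUU, mul_sum, ← sum_add_distrib]
      refine sum_congr rfl fun s _ ↦ ?_
      rw [lower_raise]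
      by_cases hs : #s = k + 1
      · rw [hs]; push_cast; ring
      · rw [hg₁ s hs]; ring
    have hinner : ∑ s, g s ^ 2 = ∑ s, raise g s * f s := by
      rw [sum_raise_mul]
      exact sum_congr rfl fun s _ ↦ sq _
    have hcs := sum_mul_sq_le_sq_mul_sq univ (raise g) f
    rw [← hinner] at hcs
    have hk' : (k : ℝ) + 1 + 1 ≤ Fintype.card α := by exact_mod_cast hk
    have hF : 0 ≤ ∑ s, f s ^ 2 := sum_nonneg fun _ _ ↦ sq_nonneg _
    have hG : 0 ≤ ∑ s, g s ^ 2 := sum_nonneg fun _ _ ↦ sq_nonneg _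
    have hle : ∑ s, raise g s ^ 2
        ≤ (k + 1) * (Fintype.card α - (k + 1 + 1)) * ∑ s, g s ^ 2 := by
      rw [hraise]; linarith
    push_cast
    rcases hG.eq_or_lt with h | h
    · rw [← h]
      have : (0 : ℝ) ≤ Fintype.card α - (k + 1 + 1) := by linarith
      positivity
    · have := hcs.trans (mul_le_mul_of_nonneg_right hle hF)
      refine le_of_mul_le_mul_right ?_ h
      linarith

/-- The spectral lower bound for the size of the shadow of a uniform family. -/
lemma card_shadow_spectral {𝒜 : Finset (Finset α)} {k : ℕ} (hk : k + 1 ≤ Fintype.card α)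
    (h𝒜 : (𝒜 : Set (Finset α)).Sized (k + 1)) :
    ((k + 1) * (Fintype.card α - k) * #𝒜 * ((Fintype.card α).choose k - #(∂ 𝒜)) : ℝ)
      ≤ k * (Fintype.card α - (k + 1)) * #(∂ 𝒜) * ((Fintype.card α).choose (k + 1) - #𝒜) := by
  set m := Fintype.card α with hm
  set N : ℝ := ((m.choose (k + 1) : ℕ) : ℝ) with hN
  set M : ℝ := ((m.choose k : ℕ) : ℝ) with hM
  have hNpos : 0 < N := by rw [hN]; exact_mod_cast Nat.choose_pos hk
  have hNM : N * (k + 1) = M * (m - k) := by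
    have h := Nat.choose_succ_right_eq m k
    rw [hN, hM, ← Nat.cast_sub (by lia)]
    exact_mod_cast h
  set a : ℝ := #𝒜 / N with ha
  have haN : a * N = #𝒜 := div_mul_cancel₀ _ hNpos.ne'
  set F : Finset α → ℝ := fun s ↦ if s ∈ 𝒜 then 1 else 0 with hF
  set L : Finset α → ℝ := fun s ↦ if #s = k + 1 then 1 else 0 with hL
  set f : Finset α → ℝ := fun s ↦ F s - a * L s with hf
  have hF₀ : ∀ s, #s ≠ k + 1 → F s = 0 := fun s hs ↦ if_neg fun h ↦ hs (h𝒜 h)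
  have hL₀ : ∀ s, #s ≠ k + 1 → L s = 0 := fun s hs ↦ if_neg hs
  have hf₀ : ∀ s, #s ≠ k + 1 → f s = 0 := fun s hs ↦ by simp [hf, hF₀ s hs, hL₀ s hs]
  have hsF : ∑ s, F s = #𝒜 := by simp [hF]
  have hsL : ∑ s, L s = N := by
    rw [hL, sum_boole, hN, hm, ← card_univ, ← card_powersetCard]
    congr 2
    ext s
    simp [mem_powersetCard]
  have hsf : ∑ s, f s = 0 := by
    simp only [hf, sum_sub_distrib, ← mul_sum, hsF, hsL, haN, sub_self]
  have hff : ∑ s, f s ^ 2 = #𝒜 * (1 - a) := by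
    have h : ∀ s, f s ^ 2 = (1 - 2 * a) * F s + a ^ 2 * L s := by
      intro s
      by_cases h₁ : s ∈ 𝒜
      · have : #s = k + 1 := h𝒜 h₁
        simp [hf, hF, hL, h₁, this]; ring
      · by_cases h₂ : #s = k + 1 <;> simp [hf, hF, hL, h₁, h₂]
    simp only [h, sum_add_distrib, ← mul_sum, hsF, hsL]
    rw [← haN]; ring
  have hDL : ∀ s, lower L s = (m - k) * if #s = k then 1 else 0 := by
    intro s
    split_ifs with hs
    · rw [lower, sum_congr rfl fun x hx ↦ ?_, sum_const, card_compl, nsmul_eq_mul, mul_one, ← hm,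
        hs, Nat.cast_sub (by lia), mul_one]
      rw [mem_compl] at hx
      simp [hL, card_insert_of_notMem hx, hs]
    · rw [lower_eq_zero hL₀ s hs, mul_zero]
  have hDf : ∀ s, lower f s = lower F s - a * lower L s := by
    intro s
    simp only [lower, hf, sum_sub_distrib, mul_sum]
  have hsM : ∑ s : Finset α, (if #s = k then (1 : ℝ) else 0) = M := by
    rw [sum_boole, hM, hm, ← card_univ, ← card_powersetCard]
    congr 2
    ext s
    simp [mem_powersetCard]
  have hDF : ∀ s, s ∉ ∂ 𝒜 → lower F s = 0 := by
    intro s hs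
    refine sum_eq_zero fun x hx ↦ if_neg fun h ↦ hs ?_
    exact mem_shadow_iff_insert_mem.2 ⟨x, mem_compl.1 hx, h⟩
  have hsDF : ∑ s, lower F s = (k + 1) * #𝒜 := by
    rw [sum_lower hF₀, hsF]; push_cast; ring
  have hcs : ((k + 1) * #𝒜 : ℝ) ^ 2 ≤ #(∂ 𝒜) * ∑ s, lower F s ^ 2 := by
    rw [← hsDF, ← sum_subset (subset_univ (∂ 𝒜)) fun s _ hs ↦ hDF s hs]
    refine sq_sum_le_card_mul_sum_sq.trans ?_
    gcongr
    exact subset_univ _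
  have hDff : ∑ s, lower f s ^ 2
      = ∑ s, lower F s ^ 2 - (k + 1) * (m - k) * a * #𝒜 := by
    have h : ∀ s, lower f s ^ 2 = lower F s ^ 2 - 2 * a * (m - k) * lower F s
        + a ^ 2 * (m - k) ^ 2 * (if #s = k then 1 else 0) := by
      intro s
      rw [hDf, hDL]
      split_ifs with hs
      · ring
      · rw [lower_eq_zero hF₀ s hs]; ring
    simp only [h, sum_add_distrib, sum_sub_distrib, ← mul_sum, hsDF, hsM]
    have : a ^ 2 * (m - k) ^ 2 * M = (k + 1) * (m - k) * a * #𝒜 := by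
      rw [← haN]; linear_combination -a ^ 2 * (m - k) * hNM
    rw [this]; ring
  have hgap := sum_sq_lower_le k hk f hf₀ hsf
  rw [hDff, hff, ← hm] at hgap
  rcases (Nat.cast_nonneg (α := ℝ) #𝒜).eq_or_lt with h₀ | hpos
  · have : 𝒜 = ∅ := by
      rw [← card_eq_zero]; exact_mod_cast h₀.symm
    simp [this]
  have h₁ := mul_le_mul_of_nonneg_left hgap (Nat.cast_nonneg (α := ℝ) #(∂ 𝒜))
  have h₂ : ((k + 1) * #𝒜 : ℝ) ^ 2 - #(∂ 𝒜) * ((k + 1) * (m - k) * a * #𝒜)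
      ≤ #(∂ 𝒜) * (k * (m - (k + 1)) * (#𝒜 * (1 - a))) := by linarith
  have hapos : 0 < a := div_pos hpos hNpos
  refine le_of_mul_le_mul_right ?_ hapos
  rw [← haN] at h₂ ⊢
  linear_combination h₂ - a ^ 2 * N * (k + 1) * hNM

/-- The spectral lower bound for the size of the iterated shadow of a uniform family. -/
lemma card_shadow_iterate_spectral {𝒜 : Finset (Finset α)} {k i : ℕ} (hik : i ≤ k)
    (hk : k < Fintype.card α) (h𝒜 : (𝒜 : Set (Finset α)).Sized k) :
    (k * (Fintype.card α - (k - i : ℕ)) * #𝒜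
        * ((Fintype.card α).choose (k - i) - #(∂^[i] 𝒜)) : ℝ)
      ≤ (k - i : ℕ) * (Fintype.card α - k) * #(∂^[i] 𝒜) * ((Fintype.card α).choose k - #𝒜) := by
  induction i with
  | zero => simp only [Nat.sub_zero, Function.iterate_zero, id_eq]; linarith
  | succ i ih =>
    have ih := ih (by lia)
    obtain ⟨j, hj⟩ : ∃ j, k - i = j + 1 := ⟨k - i - 1, by lia⟩
    have hj' : k - (i + 1) = j := by lia
    have hsized : (∂^[i] 𝒜 : Set (Finset α)).Sized (j + 1) := hj ▸ h𝒜.shadow_iterate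
    have hstep := card_shadow_spectral (by lia) hsized
    rw [← Function.iterate_succ_apply' shadow] at hstep
    have hsized' : (∂^[i + 1] 𝒜 : Set (Finset α)).Sized j := hj' ▸ h𝒜.shadow_iterate
    have hA : (#𝒜 : ℝ) ≤ (Fintype.card α).choose k := by exact_mod_cast h𝒜.card_le
    have hB : (#(∂^[i] 𝒜) : ℝ) ≤ (Fintype.card α).choose (j + 1) := by
      exact_mod_cast hsized.card_le
    have hC : (#(∂^[i + 1] 𝒜) : ℝ) ≤ (Fintype.card α).choose j := by
      exact_mod_cast hsized'.card_le
    have hBpos : (0 : ℝ) < (Fintype.card α).choose (j + 1) := by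
      exact_mod_cast Nat.choose_pos (by lia)
    rw [hj] at ih
    rw [hj']
    push_cast at ih ⊢
    have hjk : (j : ℝ) + 1 ≤ k := by exact_mod_cast (by lia : j + 1 ≤ k)
    have hkm : (k : ℝ) + 1 ≤ Fintype.card α := by exact_mod_cast hk
    have hj₀ : (0 : ℝ) ≤ j := j.cast_nonneg
    have hA₀ : (0 : ℝ) ≤ #𝒜 := Nat.cast_nonneg _
    have hB₀ : (0 : ℝ) ≤ #(∂^[i] 𝒜) := Nat.cast_nonneg _
    have hC₀ : (0 : ℝ) ≤ #(∂^[i + 1] 𝒜) := Nat.cast_nonneg _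
    generalize (#𝒜 : ℝ) = a at *
    generalize (#(∂^[i] 𝒜) : ℝ) = b at *
    generalize (#(∂^[i + 1] 𝒜) : ℝ) = c at *
    generalize ((Fintype.card α).choose k : ℝ) = A at *
    generalize ((Fintype.card α).choose (j + 1) : ℝ) = B at *
    generalize ((Fintype.card α).choose j : ℝ) = C at *
    generalize (Fintype.card α : ℝ) = m at *
    generalize (k : ℝ) = k at *
    generalize (j : ℝ) = j at *
    have hrhs : 0 ≤ j * (m - k) * c * (A - a) :=
      mul_nonneg (mul_nonneg (mul_nonneg hj₀ (by linarith)) hC₀) (by linarith)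
    rcases hB₀.eq_or_lt with hb | hb
    · have : 0 < k * (m - (j + 1)) := mul_pos (by linarith) (by linarith)
      rcases hA₀.eq_or_lt with ha | ha
      · rw [← ha] at hrhs ⊢; linarith
      · rw [← hb] at ih
        have := mul_pos (mul_pos this ha) hBpos
        linarith
    rcases hB.eq_or_lt with hb' | hb'
    · have h₁ : 0 < (j + 1) * (m - j) * b :=
        mul_pos (mul_pos (by linarith) (by linarith)) hb
      have h₂ : C - c ≤ 0 := by
        by_contra! h
        have := mul_pos h₁ h
        rw [hb', sub_self, mul_zero] at hstep
        rw [hb'] at this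
        linarith
      have h₃ : C - c = 0 := by linarith
      rw [h₃, mul_zero]; exact hrhs
    · have hpos : 0 < (j + 1) * (m - (j + 1)) * b * (B - b) :=
        mul_pos (mul_pos (mul_pos (by linarith) (by linarith)) hb) (by linarith)
      refine le_of_mul_le_mul_right ?_ hpos
      have h₁ : 0 ≤ (j + 1) * (m - j) * b * (C - c) :=
        mul_nonneg (mul_nonneg (mul_nonneg (by linarith) (by linarith)) hB₀) (by linarith)
      have h₂ : 0 ≤ (j + 1) * (m - k) * b * (A - a) :=
        mul_nonneg (mul_nonneg (mul_nonneg (by linarith) (by linarith)) hB₀) (by linarith)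
      have := mul_le_mul ih hstep h₁ h₂
      linarith

end LevelOperators

section KruskalKatona

open Finset Finset.Colex
open scoped FinsetFamily

lemma exists_isInitSeg_card_eq {α : Type*} [LinearOrder α] [Fintype α] {r t : ℕ}
    (ht : t ≤ (Fintype.card α).choose r) :
    ∃ 𝒞 : Finset (Finset α), IsInitSeg 𝒞 r ∧ #𝒞 = t := by
  induction t with
  | zero => exact ⟨∅, by simp, rfl⟩
  | succ t ih =>
    obtain ⟨𝒞, h𝒞, rfl⟩ := ih (by lia)
    have hne : (powersetCard r univ \ 𝒞).Nonempty := by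
      rw [sdiff_nonempty]
      intro h
      have := card_le_card h
      rw [card_powersetCard, card_univ] at this
      lia
    obtain ⟨s, hs, hmin⟩ := exists_min_image _ toColex hne
    simp only [mem_sdiff, mem_powersetCard, subset_univ, true_and] at hs hmin
    refine ⟨insert s 𝒞, ⟨?_, ?_⟩, card_insert_of_notMem hs.2⟩
    · intro u hu
      rcases mem_insert.1 hu with rfl | hu
      · exact hs.1
      · exact h𝒞.1 hu
    · rintro u v hu ⟨hvu, hv⟩
      by_contra hv'
      rw [mem_insert, not_or] at hv'
      rcases mem_insert.1 hu with rfl | hu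
      · exact (hmin v ⟨hv, hv'.2⟩).not_gt hvu
      · exact hv'.2 (h𝒞.2 hu ⟨hvu, hv⟩)

variable {m r i : ℕ}

/-- The members of a family avoiding the last element. -/
def deletionLast (𝒜 : Finset (Finset (Fin (m + 1)))) : Finset (Finset (Fin m)) :=
  {s | s.map Fin.castSuccEmb ∈ 𝒜}

/-- The members of a family containing the last element, with that element removed. -/
def linkLast (𝒜 : Finset (Finset (Fin (m + 1)))) : Finset (Finset (Fin m)) :=
  {s | insert (Fin.last m) (s.map Fin.castSuccEmb) ∈ 𝒜}

lemma last_notMem_map (s : Finset (Fin m)) : Fin.last m ∉ s.map Fin.castSuccEmb := by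
  simp [Fin.castSucc_ne_last]

lemma exists_map_castSuccEmb_eq {s : Finset (Fin (m + 1))} (hs : Fin.last m ∉ s) :
    ∃ t : Finset (Fin m), t.map Fin.castSuccEmb = s := by
  refine ⟨univ.filter fun x ↦ x.castSucc ∈ s, ?_⟩
  ext x
  induction x using Fin.lastCases with
  | last => simp [hs, Fin.castSucc_ne_last]
  | cast x => simp

lemma card_deletionLast_add_card_linkLast (𝒜 : Finset (Finset (Fin (m + 1)))) :
    #(deletionLast 𝒜) + #(linkLast 𝒜) = #𝒜 := by
  rw [← card_filter_add_card_filter_not (s := 𝒜) (fun s ↦ Fin.last m ∉ s)]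
  congr 1
  · refine card_bij (fun s _ ↦ s.map Fin.castSuccEmb) ?_ ?_ ?_
    · intro s hs
      exact mem_filter.2 ⟨by simpa [deletionLast] using hs, last_notMem_map s⟩
    · intro s _ t _ h
      exact map_injective _ h
    · intro s hs
      obtain ⟨hs, hl⟩ := mem_filter.1 hs
      obtain ⟨t, rfl⟩ := exists_map_castSuccEmb_eq hl
      exact ⟨t, by simpa [deletionLast] using hs, rfl⟩
  · refine card_bij (fun s _ ↦ insert (Fin.last m) (s.map Fin.castSuccEmb)) ?_ ?_ ?_
    · intro s hs
      exact mem_filter.2 ⟨by simpa [linkLast] using hs, by simp⟩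
    · intro s _ t _ h
      have := congrArg (fun u ↦ u.erase (Fin.last m)) h
      simp only [erase_insert (last_notMem_map _)] at this
      exact map_injective _ this
    · intro s hs
      obtain ⟨hs, hl⟩ := mem_filter.1 hs
      obtain ⟨t, ht⟩ := exists_map_castSuccEmb_eq (notMem_erase (Fin.last m) s)
      have h : insert (Fin.last m) (t.map Fin.castSuccEmb) = s := by
        rw [ht, insert_erase (not_not.1 hl)]
      exact ⟨t, by simpa [linkLast, h] using hs, h⟩

lemma sized_deletionLast {𝒜 : Finset (Finset (Fin (m + 1)))}
    (h𝒜 : (𝒜 : Set (Finset (Fin (m + 1)))).Sized r) :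
    (deletionLast 𝒜 : Set (Finset (Fin m))).Sized r := by
  intro s hs
  have hs : s.map Fin.castSuccEmb ∈ 𝒜 := by simpa [deletionLast] using hs
  simpa using h𝒜 hs

lemma sized_linkLast {𝒜 : Finset (Finset (Fin (m + 1)))}
    (h𝒜 : (𝒜 : Set (Finset (Fin (m + 1)))).Sized (r + 1)) :
    (linkLast 𝒜 : Set (Finset (Fin m))).Sized r := by
  intro s hs
  have hs : insert (Fin.last m) (s.map Fin.castSuccEmb) ∈ 𝒜 := by simpa [linkLast] using hs
  have := h𝒜 hs
  rw [card_insert_of_notMem (last_notMem_map s), card_map] at this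
  lia

lemma shadow_iterate_linkLast_subset (𝒜 : Finset (Finset (Fin (m + 1)))) :
    ∂^[i] (linkLast 𝒜) ⊆ linkLast (∂^[i] 𝒜) := by
  intro t ht
  obtain ⟨s, hs, hts, hcard⟩ := mem_shadow_iterate_iff_exists_sdiff.1 ht
  refine mem_filter.2 ⟨mem_univ _, mem_shadow_iterate_iff_exists_sdiff.2
    ⟨_, (mem_filter.1 hs).2, insert_subset_insert _ (map_subset_map.2 hts), ?_⟩⟩
  rw [insert_sdiff_insert, sdiff_insert_of_notMem (last_notMem_map s), ← Finset.map_sdiff,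
    card_map, hcard]

lemma shadow_iterate_deletionLast_subset (𝒜 : Finset (Finset (Fin (m + 1)))) :
    ∂^[i] (deletionLast 𝒜) ⊆ deletionLast (∂^[i] 𝒜) := by
  intro t ht
  obtain ⟨s, hs, hts, hcard⟩ := mem_shadow_iterate_iff_exists_sdiff.1 ht
  refine mem_filter.2 ⟨mem_univ _, mem_shadow_iterate_iff_exists_sdiff.2
    ⟨_, (mem_filter.1 hs).2, map_subset_map.2 hts, ?_⟩⟩
  rw [← Finset.map_sdiff, card_map, hcard]

/-- A large initial segment contains every set avoiding the last element. -/
lemma deletionLast_of_isInitSeg {𝒞 : Finset (Finset (Fin (m + 1)))} (h𝒞 : IsInitSeg 𝒞 r)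
    (hcard : m.choose r ≤ #𝒞) : deletionLast 𝒞 = powersetCard r univ := by
  set ℬ : Finset (Finset (Fin (m + 1))) := {s | #s = r ∧ Fin.last m ∉ s} with hℬ
  have hmem : ∀ s : Finset (Fin m), #s = r → s.map Fin.castSuccEmb ∈ ℬ := fun s hs ↦
    mem_filter.2 ⟨mem_univ _, by simpa using hs, last_notMem_map s⟩
  have hℬseg : IsInitSeg ℬ r := by
    refine ⟨fun s hs ↦ (mem_filter.1 hs).2.1, fun s t hs ⟨hlt, ht⟩ ↦ ?_⟩
    refine mem_filter.2 ⟨mem_univ _, ht, fun hl ↦ ?_⟩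
    have hs' := (mem_filter.1 hs).2.2
    obtain ⟨w, hw, hfilter⟩ := lt_iff_exists_filter_lt.1 hlt
    have hws := (mem_sdiff.1 hw).1
    have hwl : w < Fin.last m := lt_of_le_of_ne (Fin.le_last w) (by rintro rfl; exact hs' hws)
    have : Fin.last m ∈ ({a ∈ t | w < a} : Finset _) := mem_filter.2 ⟨hl, hwl⟩
    rw [hfilter] at this
    exact hs' (mem_filter.1 this).1
  have hℬcard : #ℬ ≤ m.choose r := by
    have h : ℬ ⊆ (powersetCard r (univ : Finset (Fin m))).map
        (mapEmbedding Fin.castSuccEmb).toEmbedding := by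
      intro s hs
      obtain ⟨-, hs, hl⟩ := mem_filter.1 hs
      obtain ⟨t, rfl⟩ := exists_map_castSuccEmb_eq hl
      exact mem_map.2 ⟨t, mem_powersetCard.2 ⟨subset_univ _, by simpa using hs⟩, rfl⟩
    simpa using card_le_card h
  have hsub : ℬ ⊆ 𝒞 := by
    rcases h𝒞.total hℬseg with h | h
    · exact (eq_of_subset_of_card_le h (hℬcard.trans hcard)).ge
    · exact h
  ext s
  simp only [deletionLast, mem_filter, mem_univ, true_and, mem_powersetCard, subset_univ]
  exact ⟨fun hs ↦ by simpa using h𝒞.1 hs, fun hs ↦ hsub (hmem s hs)⟩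

/-- A recursive form of Kruskal-Katona for families with at least `m.choose r` members. -/
lemma exists_link_card_shadow_le {𝒜 : Finset (Finset (Fin (m + 1)))} (hrm : r + 1 ≤ m)
    (hi : i ≤ r) (h𝒜 : (𝒜 : Set (Finset (Fin (m + 1)))).Sized (r + 1))
    (hcard : m.choose (r + 1) ≤ #𝒜) :
    ∃ 𝒟 : Finset (Finset (Fin m)), (𝒟 : Set (Finset (Fin m))).Sized r ∧
      m.choose (r + 1) + #𝒟 = #𝒜 ∧ m.choose (r + 1 - i) + #(∂^[i] 𝒟) ≤ #(∂^[i] 𝒜) := by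
  obtain ⟨𝒞, h𝒞, h𝒞card⟩ := exists_isInitSeg_card_eq h𝒜.card_le
  have hdel := deletionLast_of_isInitSeg h𝒞 (h𝒞card ▸ hcard)
  have hsplit := card_deletionLast_add_card_linkLast 𝒞
  rw [hdel, card_powersetCard, card_univ, Fintype.card_fin, h𝒞card] at hsplit
  refine ⟨linkLast 𝒞, sized_linkLast h𝒞.1, hsplit, ?_⟩
  refine le_trans ?_ (iterated_kk h𝒜 h𝒞card.le h𝒞)
  rw [← card_deletionLast_add_card_linkLast]
  refine add_le_add ?_ (card_le_card (shadow_iterate_linkLast_subset 𝒞))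
  refine le_trans ?_ (card_le_card (shadow_iterate_deletionLast_subset 𝒞))
  refine kruskal_katona_lovasz_form (by lia) hrm le_rfl (sized_deletionLast h𝒞.1) ?_
  simp [hdel]

end KruskalKatona

section CrossIntersecting

open Finset
open scoped FinsetFamily

/-- The product bound for cross-intersecting families, when the first one is large. -/
lemma card_mul_card_le_of_large {m a b : ℕ} (ha : 2 * (a + 1) ≤ m + 1) (hb : 2 * (b + 1) ≤ m + 1)
    {𝒜 ℬ : Finset (Finset (Fin (m + 1)))}
    (h𝒜 : (𝒜 : Set (Finset (Fin (m + 1)))).Sized (a + 1))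
    (hℬ : (ℬ : Set (Finset (Fin (m + 1)))).Sized (b + 1))
    (hcross : ∀ s ∈ 𝒜, ∀ t ∈ ℬ, ¬ Disjoint s t) (hcard : m.choose a ≤ #𝒜) :
    #𝒜 * #ℬ ≤ m.choose a * m.choose b := by
  obtain ⟨r, hr⟩ : ∃ r, r + 1 + a = m := ⟨m - a - 1, by lia⟩
  obtain ⟨i, hi⟩ : ∃ i, i + b = r := ⟨r - b, by lia⟩
  have hcompl : (𝒜ᶜˢ : Set (Finset (Fin (m + 1)))).Sized (r + 1) := by
    have := h𝒜.compls
    rwa [Fintype.card_fin, (by lia : m + 1 - (a + 1) = r + 1)] at this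
  have hsymm : m.choose (r + 1) = m.choose a := Nat.choose_symm_of_eq_add hr.symm
  obtain ⟨𝒟, h𝒟, h𝒟card, hshadow⟩ := exists_link_card_shadow_le (i := i) (by lia) (by lia) hcompl
    (by rwa [card_compls, hsymm])
  rw [card_compls, hsymm] at h𝒟card
  rw [(by lia : r + 1 - i = b + 1)] at hshadow
  have hdisj : Disjoint ℬ (∂^[i] 𝒜ᶜˢ) := disjoint_right.2 fun t ht htℬ ↦ by
    obtain ⟨s, hs, hts, -⟩ := mem_shadow_iterate_iff_exists_sdiff.1 ht
    exact hcross _ (mem_compls.1 hs) _ htℬ (disjoint_compl_left.mono_right hts)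
  have hunion : #ℬ + #(∂^[i] 𝒜ᶜˢ) ≤ (m + 1).choose (b + 1) := by
    rw [← card_union_of_disjoint hdisj]
    have h : ((ℬ ∪ ∂^[i] 𝒜ᶜˢ : Finset _) : Set (Finset (Fin (m + 1)))).Sized (b + 1) := by
      rw [coe_union, Set.sized_union]
      refine ⟨hℬ, ?_⟩
      have := hcompl.shadow_iterate (k := i)
      rwa [(by lia : r + 1 - i = b + 1)] at this
    simpa using h.card_le
  rw [Nat.choose_succ_succ] at hunion
  have hbound : #ℬ + #(∂^[i] 𝒟) ≤ m.choose b := by lia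
  suffices h : (#𝒟 * (m.choose b - #(∂^[i] 𝒟)) : ℝ) ≤ m.choose a * #(∂^[i] 𝒟) by
    rw [← h𝒟card]
    have hbound' : (#ℬ : ℝ) ≤ m.choose b - #(∂^[i] 𝒟) := by
      rw [le_sub_iff_add_le]; exact_mod_cast hbound
    have : ((m.choose a + #𝒟) * #ℬ : ℝ) ≤ m.choose a * m.choose b := by
      refine (mul_le_mul_of_nonneg_left hbound' (by positivity)).trans ?_
      linarith
    exact_mod_cast this
  have hspec := card_shadow_iterate_spectral (i := i) (by lia) (by rw [Fintype.card_fin]; lia) h𝒟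
  rw [Fintype.card_fin, (by lia : r - i = b)] at hspec
  have hchoose : (m.choose r * (a + 1) : ℝ) = m.choose a * (r + 1) := by
    have h := Nat.choose_succ_right_eq m a
    rw [Nat.choose_symm_of_eq_add (by lia : m = (a + 1) + r), (by lia : m - a = r + 1)] at h
    exact_mod_cast h
  have hmr : (m : ℝ) = r + 1 + a := by exact_mod_cast hr.symm
  have hri : (r : ℝ) = i + b := by exact_mod_cast hi.symm
  rcases Nat.eq_zero_or_pos r with rfl | hrpos
  · obtain ⟨rfl, rfl⟩ : i = 0 ∧ b = 0 := by lia
    have hZ : (1 : ℝ) ≤ m.choose a := by exact_mod_cast Nat.choose_pos (by lia)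
    simp only [Function.iterate_zero, id_eq, Nat.choose_zero_right, Nat.cast_one]
    nlinarith [Nat.cast_nonneg (α := ℝ) #𝒟]
  · have hb' : (2 * (b + 1) : ℝ) ≤ m + 1 := by exact_mod_cast hb
    have hr₀ : (0 : ℝ) < r := by exact_mod_cast hrpos
    have hb₀ : (0 : ℝ) ≤ b := b.cast_nonneg
    have hi₀ : (0 : ℝ) ≤ i := i.cast_nonneg
    have hx : (0 : ℝ) ≤ #𝒟 := Nat.cast_nonneg _
    have hy : (0 : ℝ) ≤ #(∂^[i] 𝒟) := Nat.cast_nonneg _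
    have hZ : (0 : ℝ) ≤ m.choose a := Nat.cast_nonneg _
    have ha₀ : (0 : ℝ) ≤ a := a.cast_nonneg
    have hpos : (0 : ℝ) < r * (m - b) := mul_pos hr₀ (by linarith)
    have hcoef : (b * (r + 1) : ℝ) ≤ r * (m - b) := by nlinarith
    refine le_of_mul_le_mul_left ?_ hpos
    have h₁ := mul_le_mul_of_nonneg_right hcoef (mul_nonneg hZ hy)
    have h₂ : (0 : ℝ) ≤ b * (m - r) * #(∂^[i] 𝒟) * #𝒟 :=
      mul_nonneg (mul_nonneg (mul_nonneg hb₀ (by linarith)) hy) hx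
    have h₃ : (b * (m - r) * #(∂^[i] 𝒟) * m.choose r : ℝ)
        = b * (r + 1) * (m.choose a * #(∂^[i] 𝒟)) := by
      rw [hmr]; linear_combination (b * #(∂^[i] 𝒟) : ℝ) * hchoose
    linarith

end CrossIntersecting


/-- Matsumoto–Tokushige (Lemma 3.1): if `n ≥ max{2k₁, 2k₂}` and
`|H₁|·|H₂| > C(n-1,k₁-1)·C(n-1,k₂-1)` for `Hᵢ ⊆ C([n],kᵢ)`, then there exist
disjoint `e₁ ∈ H₁` and `e₂ ∈ H₂`. -/
theorem matsumoto_tokushige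
    (n k₁ k₂ : ℕ) (hk₁ : 1 ≤ k₁) (hk₂ : 1 ≤ k₂)
    (hn₁ : n ≥ 2 * k₁) (hn₂ : n ≥ 2 * k₂)
    (H₁ H₂ : Finset (Finset (Fin n)))
    (hH₁ : ∀ e ∈ H₁, e.card = k₁) (hH₂ : ∀ e ∈ H₂, e.card = k₂)
    (hprod : H₁.card * H₂.card > (n - 1).choose (k₁ - 1) * (n - 1).choose (k₂ - 1)) :
    ∃ e₁ ∈ H₁, ∃ e₂ ∈ H₂, Disjoint e₁ e₂ := by
  obtain ⟨m, rfl⟩ : ∃ m, n = m + 1 := ⟨n - 1, by lia⟩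
  obtain ⟨a, rfl⟩ : ∃ a, k₁ = a + 1 := ⟨k₁ - 1, by lia⟩
  obtain ⟨b, rfl⟩ : ∃ b, k₂ = b + 1 := ⟨k₂ - 1, by lia⟩
  simp only [Nat.add_sub_cancel] at hprod
  by_contra! hcross
  have hlarge : m.choose a ≤ H₁.card ∨ m.choose b ≤ H₂.card := by
    by_contra! h
    exact hprod.not_ge (Nat.mul_le_mul h.1.le h.2.le)
  rcases hlarge with h | h
  · exact hprod.not_ge
      (card_mul_card_le_of_large hn₁ hn₂ (fun s hs ↦ hH₁ s hs) (fun s hs ↦ hH₂ s hs) hcross h)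
  · have := card_mul_card_le_of_large hn₂ hn₁ (fun s hs ↦ hH₂ s hs) (fun s hs ↦ hH₁ s hs)
      (fun s hs t ht hst ↦ hcross t ht s hs hst.symm) h
    rw [mul_comm, mul_comm (m.choose b)] at this
    exact hprod.not_ge this
end
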